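/- For every real c > 0, with a := log c, the nested toy-model integral I₂ has the Laurent behaviour I₂(c,ε) = 1/(2ε²) - a/ε + a² + 5π²/12 + O(ε): the limit as ε → 0⁺ of (I₂(c,ε) - 1/(2ε²) + (log c)/ε) equals (log c)² + 5π²/12. -/

import Mathlib

open MeasureTheory Real Filter

noncomputable section

/-- The toy-model integral `I₁(c,ε) = ∫₀^∞ y^{-ε}/(y+c) dy`. -/
def I1 (c ε : ℝ) : ℝ := ∫ y in Set.Ioi (0 : ℝ), y ^ (-ε) / (y + c)

/-- The nested toy-model integral of the two-vertex ladder tree,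
`I₂(c,ε) = ∫₀^∞ (y^{-ε}/(y+c)) I₁(y,ε) dy`. -/
def I2 (c ε : ℝ) : ℝ := ∫ y in Set.Ioi (0 : ℝ), (y ^ (-ε) / (y + c)) * I1 y ε

theorem lintegral_rpow_mul_exp_neg_mul_Ioi {a r : ℝ} (ha : 0 < a) (hr : 0 < r) :
    ∫⁻ t in Set.Ioi (0 : ℝ), ENNReal.ofReal (t ^ (a - 1) * exp (-(r * t))) =
      ENNReal.ofReal ((1 / r) ^ a * Gamma a) := by
  have h := Real.integral_rpow_mul_exp_neg_mul_Ioi ha hr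
  have hpos : 0 < (1 / r) ^ a * Gamma a := by
    have := Gamma_pos_of_pos ha
    positivity
  rw [← h, ofReal_integral_eq_lintegral_ofReal]
  · by_contra hn
    rw [integral_undef hn] at h
    exact hpos.ne h
  · filter_upwards [ae_restrict_mem measurableSet_Ioi] with t ht
    have : (0 : ℝ) < t := ht
    simp only [Pi.zero_apply]
    positivity

/-- The integral `I1` in closed form, by writing `1 / (y + c)` as a Laplace transform and
exchanging the order of integration. -/
theorem I1_eq {c ε : ℝ} (hc : 0 < c) (h0 : 0 < ε) (h1 : ε < 1) :
    I1 c ε = c ^ (-ε) * (π / sin (π * ε)) := by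
  have hΓ : 0 < Gamma (1 - ε) := Gamma_pos_of_pos (by linarith)
  have hΓ' : 0 < Gamma ε := Gamma_pos_of_pos h0
  have key : ∫⁻ y in Set.Ioi (0 : ℝ), ENNReal.ofReal (y ^ (-ε) / (y + c)) =
      ENNReal.ofReal (c ^ (-ε) * (Gamma ε * Gamma (1 - ε))) := by
    calc
      _ = ∫⁻ y in Set.Ioi (0 : ℝ), ∫⁻ t in Set.Ioi (0 : ℝ),
            ENNReal.ofReal (y ^ (-ε) * exp (-((y + c) * t))) := by
        refine setLIntegral_congr_fun measurableSet_Ioi fun y hy => ?_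
        have hy : (0 : ℝ) < y := hy
        have h := lintegral_rpow_mul_exp_neg_mul_Ioi one_pos (add_pos hy hc)
        simp only [sub_self, rpow_zero, one_mul, rpow_one, Gamma_one, mul_one] at h
        simp only [ENNReal.ofReal_mul (rpow_nonneg hy.le (-ε))]
        rw [lintegral_const_mul' _ _ ENNReal.ofReal_ne_top, h,
          ← ENNReal.ofReal_mul (rpow_nonneg hy.le _), mul_one_div]
      _ = ∫⁻ t in Set.Ioi (0 : ℝ), ∫⁻ y in Set.Ioi (0 : ℝ),
            ENNReal.ofReal (y ^ (-ε) * exp (-((y + c) * t))) :=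
        lintegral_lintegral_swap (Measurable.aemeasurable (by fun_prop))
      _ = ∫⁻ t in Set.Ioi (0 : ℝ), ENNReal.ofReal (Gamma (1 - ε)) *
            ENNReal.ofReal (t ^ (ε - 1) * exp (-(c * t))) := by
        refine setLIntegral_congr_fun measurableSet_Ioi fun t ht => ?_
        have ht : (0 : ℝ) < t := ht
        have h := lintegral_rpow_mul_exp_neg_mul_Ioi (a := 1 - ε) (by linarith) ht
        rw [show 1 - ε - 1 = -ε by ring] at h
        have hsplit : ∀ y : ℝ, ENNReal.ofReal (y ^ (-ε) * exp (-((y + c) * t))) =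
            ENNReal.ofReal (exp (-(c * t))) * ENNReal.ofReal (y ^ (-ε) * exp (-(t * y))) := by
          intro y
          rw [← ENNReal.ofReal_mul (exp_pos _).le, mul_left_comm, ← exp_add]
          ring_nf
        simp only [hsplit]
        rw [lintegral_const_mul' _ _ ENNReal.ofReal_ne_top, h,
          ← ENNReal.ofReal_mul (exp_pos _).le, ← ENNReal.ofReal_mul hΓ.le, one_div,
          inv_rpow ht.le, ← rpow_neg ht.le, neg_sub]
        ring_nf
      _ = _ := by
        rw [lintegral_const_mul' _ _ ENNReal.ofReal_ne_top,
          lintegral_rpow_mul_exp_neg_mul_Ioi h0 hc, ← ENNReal.ofReal_mul hΓ.le, one_div,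
          inv_rpow hc.le, ← rpow_neg hc.le]
        ring_nf
  rw [I1, integral_eq_lintegral_of_nonneg_ae, key, ENNReal.toReal_ofReal (by positivity),
    Gamma_mul_Gamma_one_sub]
  · filter_upwards [ae_restrict_mem measurableSet_Ioi] with y hy
    have : (0 : ℝ) < y := hy
    simp only [Pi.zero_apply]
    positivity
  · exact Measurable.aestronglyMeasurable (by fun_prop)

theorem I2_eq {c ε : ℝ} (hc : 0 < c) (h0 : 0 < ε) (h1 : ε < 1 / 2) :
    I2 c ε = c ^ (-(2 * ε)) * (π / sin (π * (2 * ε))) * (π / sin (π * ε)) := by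
  rw [← I1_eq hc (by linarith) (by linarith), I1, ← integral_mul_const, I2]
  refine setIntegral_congr_fun measurableSet_Ioi fun y hy => ?_
  have hy : (0 : ℝ) < y := hy
  rw [I1_eq hy h0 (by linarith), show -(2 * ε) = -ε + -ε by ring, rpow_add hy]
  ring

theorem tendsto_sub_sin_div_pow_three :
    Tendsto (fun x : ℝ => (x - sin x) / x ^ 3) (nhdsWithin 0 (Set.Ioi 0)) (nhds (1 / 6)) := by
  rw [← tendsto_sub_nhds_zero_iff]
  have hlim : Tendsto (fun x : ℝ => x ^ 2 / 100) (nhdsWithin 0 (Set.Ioi 0)) (nhds 0) := by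
    exact tendsto_nhdsWithin_of_tendsto_nhds (Continuous.tendsto' (by fun_prop) _ _ (by simp))
  refine squeeze_zero_norm' ?_ hlim
  filter_upwards [Ioo_mem_nhdsGT one_pos] with x ⟨hx0, hx1⟩
  have h := Real.sin_bound (x := x) (by rw [abs_of_pos hx0]; exact hx1.le)
  have heq : (x - sin x) / x ^ 3 - 1 / 6 = -(sin x - (x - x ^ 3 / 6)) / x ^ 3 := by
    field_simp
    ring
  rw [heq, norm_eq_abs, abs_div, abs_neg, abs_of_pos (pow_pos hx0 3), div_le_iff₀ (pow_pos hx0 3)]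
  rw [abs_of_pos hx0] at h
  linarith

theorem tendsto_div_sin :
    Tendsto (fun x : ℝ => x / sin x) (nhdsWithin 0 (Set.Ioi 0)) (nhds 1) := by
  have h : Tendsto (fun x : ℝ => (sinc x)⁻¹) (nhdsWithin 0 (Set.Ioi 0)) (nhds 1) := by
    refine tendsto_nhdsWithin_of_tendsto_nhds ?_
    have := (continuous_sinc.tendsto 0).inv₀ (by simp)
    simpa using this
  refine h.congr' ?_
  filter_upwards [self_mem_nhdsWithin] with x hx
  rw [sinc_of_ne_zero (ne_of_gt hx), inv_div]

theorem tendsto_div_sin_sub_one_div_sq :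
    Tendsto (fun x : ℝ => (x / sin x - 1) / x ^ 2) (nhdsWithin 0 (Set.Ioi 0)) (nhds (1 / 6)) := by
  have h := tendsto_sub_sin_div_pow_three.mul tendsto_div_sin
  rw [mul_one] at h
  refine h.congr' ?_
  filter_upwards [Ioo_mem_nhdsGT pi_pos] with x ⟨hx0, hx1⟩
  have := sin_pos_of_pos_of_lt_pi hx0 hx1
  field_simp

theorem tendsto_exp_mul_sub_div_sq (k : ℝ) :
    Tendsto (fun x : ℝ => (exp (k * x) - 1 - k * x) / x ^ 2) (nhdsWithin 0 (Set.Ioi 0))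
      (nhds (k ^ 2 / 2)) := by
  rw [← tendsto_sub_nhds_zero_iff]
  have hlim : Tendsto (fun x : ℝ => |k| ^ 3 * x * (2 / 9)) (nhdsWithin 0 (Set.Ioi 0))
      (nhds 0) :=
    tendsto_nhdsWithin_of_tendsto_nhds (Continuous.tendsto' (by fun_prop) _ _ (by simp))
  have hsmall : Tendsto (fun x : ℝ => |k * x|) (nhdsWithin 0 (Set.Ioi 0)) (nhds 0) :=
    tendsto_nhdsWithin_of_tendsto_nhds (Continuous.tendsto' (by fun_prop) _ _ (by simp))
  refine squeeze_zero_norm' ?_ hlim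
  filter_upwards [self_mem_nhdsWithin, hsmall.eventually_le_const one_pos] with x hx hkx
  have hx0 : 0 < x := hx
  have h := Real.exp_bound hkx (n := 3) (by norm_num)
  norm_num [Finset.sum_range_succ, Nat.factorial] at h
  have heq : (exp (k * x) - 1 - k * x) / x ^ 2 - k ^ 2 / 2 =
      (exp (k * x) - (1 + k * x + (k * x) ^ 2 / 2)) / x ^ 2 := by
    field_simp
    ring
  rw [heq, norm_eq_abs, abs_div, abs_of_pos (pow_pos hx0 2), div_le_iff₀ (pow_pos hx0 2)]
  refine h.trans_eq ?_
  rw [abs_of_pos hx0]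
  ring

theorem tendsto_const_mul_nhdsGT_zero {k : ℝ} (hk : 0 < k) :
    Tendsto (fun x : ℝ => k * x) (nhdsWithin 0 (Set.Ioi 0)) (nhdsWithin 0 (Set.Ioi 0)) := by
  refine tendsto_nhdsWithin_iff.2 ⟨tendsto_nhdsWithin_of_tendsto_nhds
    (Continuous.tendsto' (by fun_prop) _ _ (by simp)), ?_⟩
  filter_upwards [self_mem_nhdsWithin] with x hx
  exact mul_pos hk hx

/-- Laurent behaviour `I₂(c,ε) = 1/(2ε²) - a/ε + a² + 5π²/12 + O(ε)` with
`a = log c`:  `I₂(c,ε) - 1/(2ε²) + (log c)/ε → (log c)² + 5π²/12` as `ε → 0⁺`. -/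
theorem toy_model_I2_laurent (c : ℝ) (hc : 0 < c) :
    Tendsto (fun ε : ℝ => I2 c ε - 1 / (2 * ε ^ 2) + Real.log c / ε)
      (nhdsWithin 0 (Set.Ioi 0))
      (nhds ((Real.log c) ^ 2 + 5 * π ^ 2 / 12)) := by
  have hE : Tendsto (fun ε : ℝ => exp (-2 * log c * ε)) (nhdsWithin 0 (Set.Ioi 0)) (nhds 1) :=
    tendsto_nhdsWithin_of_tendsto_nhds (Continuous.tendsto' (by fun_prop) _ _ (by simp))
  have hm := tendsto_const_mul_nhdsGT_zero pi_pos
  have hm2 := tendsto_const_mul_nhdsGT_zero two_pi_pos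
  have hA := ((tendsto_div_sin_sub_one_div_sq.comp hm2).const_mul ((2 * π) ^ 2)).mul
    (tendsto_div_sin.comp hm)
  have hB := (tendsto_div_sin_sub_one_div_sq.comp hm).const_mul (π ^ 2)
  have hmain := ((tendsto_exp_mul_sub_div_sq (-2 * log c)).add
    (hE.mul (hA.add hB))).div_const 2
  rw [show (log c) ^ 2 + 5 * π ^ 2 / 12 = ((-2 * log c) ^ 2 / 2 +
    1 * ((2 * π) ^ 2 * (1 / 6) * 1 + π ^ 2 * (1 / 6))) / 2 by ring]
  refine hmain.congr' ?_
  filter_upwards [Ioo_mem_nhdsGT (show (0 : ℝ) < 1 / 2 by norm_num)] with ε ⟨h0, h1⟩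
  have hs : 0 < sin (π * ε) :=
    sin_pos_of_pos_of_lt_pi (by positivity) (by nlinarith [pi_pos])
  have hs2 : 0 < sin (2 * π * ε) :=
    sin_pos_of_pos_of_lt_pi (by positivity) (by nlinarith [pi_pos])
  have hpi := pi_pos
  rw [I2_eq hc h0 h1, rpow_def_of_pos hc, show log c * -(2 * ε) = -2 * log c * ε by ring,
    show π * (2 * ε) = 2 * π * ε by ring]
  simp only [Function.comp_apply]
  generalize exp (-2 * log c * ε) = E
  field_simp
  ring

end
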